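/- arXiv:1601.01508 — 2 statements merged into one kernel-verified Lean document; each statement's English description precedes it below -/
import Mathlib

section
/- Let k be a field of characteristic zero and let f_1,…,f_m ∈ k[x_1,…,x_n] be algebraically independent over k, with 1 ≤ m ≤ n. Then dgcd(f_1,…,f_m) is a nonzero element of k if and only if for every irreducible polynomial w ∈ k[x_1,…,x_m] the polynomial w(f_1,…,f_m) is square-free in k[x_1,…,x_n]. -/
open MvPolynomial

/-- The Jacobian determinant of `f₁, …, f_m` with respect to the variables
`x_{i 1}, …, x_{i m}`. -/
noncomputable def jacDet {k : Type*} [Field k] {m n : ℕ}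
    (f : Fin m → MvPolynomial (Fin n) k) (i : Fin m → Fin n) : MvPolynomial (Fin n) k :=
  Matrix.det (Matrix.of fun j l => pderiv (i l) (f j))

/-- `d` is a greatest common divisor (in the UFD `k[x₁,…,xₙ]`) of all Jacobian
determinants `jac^{f₁,…,f_m}_{x_{i₁},…,x_{i_m}}`, `1 ≤ i₁ < … < i_m ≤ n`;
strictly increasing sequences `i₁ < … < i_m` are encoded as strictly monotone
maps `Fin m → Fin n`.  (Note that this forces `d = 0` when all the Jacobian
determinants vanish.) -/
def IsDgcd {k : Type*} [Field k] {m n : ℕ}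
    (f : Fin m → MvPolynomial (Fin n) k) (d : MvPolynomial (Fin n) k) : Prop :=
  (∀ i : Fin m → Fin n, StrictMono i → d ∣ jacDet f i) ∧
  ∀ e : MvPolynomial (Fin n) k, (∀ i : Fin m → Fin n, StrictMono i → e ∣ jacDet f i) → e ∣ d


lemma aux_lift {A K B : Type*} [CommRing A] [Field K] [CommRing B] [Algebra A K]
    [Algebra.FormallySmooth A K] (ψ : A →+* B) (π : B →+* K) (hπ : Function.Surjective π)
    (hk : ∀ x y, π x = 0 → π y = 0 → x * y = 0) (hc : ∀ a, π (ψ a) = algebraMap A K a) :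
    ∃ L : K →+* B, (∀ x, π (L x) = x) ∧ ∀ a, L (algebraMap A K a) = ψ a := by
  letI : Algebra A B := ψ.toAlgebra
  let g : B →ₐ[A] K := { π with commutes' := hc }
  have hg : IsNilpotent (RingHom.ker (g : B →+* K)) := by
    refine ⟨2, ?_⟩
    rw [pow_two, Ideal.zero_eq_bot, eq_bot_iff, Ideal.mul_le]
    intro x hx y hy
    exact hk x y hx hy
  let L := Algebra.FormallySmooth.liftOfSurjective (AlgHom.id A K) g hπ hg
  refine ⟨L.toRingHom, fun x => Algebra.FormallySmooth.liftOfSurjective_apply _ g hπ hg x,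
    fun a => L.commutes a⟩

lemma exists_der {k K ι : Type*} [Field k] [CharZero k] [Field K] [Algebra k K]
    [Algebra.EssFiniteType k K] (x : ι → K) (hx : AlgebraicIndependent k x) (c : ι → K) :
    ∃ D : Derivation k K K, ∀ i, D (x i) = c i := by
  letI : Algebra (MvPolynomial ι k) K := (aeval x).toRingHom.toAlgebra
  have hA : ∀ p : MvPolynomial ι k, algebraMap (MvPolynomial ι k) K p = aeval x p := fun p => rfl
  haveI : IsScalarTower k (MvPolynomial ι k) K := .of_algebraMap_eq fun r => by
    rw [hA]; simp [MvPolynomial.algebraMap_eq]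
  haveI : FaithfulSMul (MvPolynomial ι k) K := (faithfulSMul_iff_algebraMap_injective _ _).2 hx
  letI : Algebra (FractionRing (MvPolynomial ι k)) K := FractionRing.liftAlgebra _ K
  haveI : IsScalarTower (MvPolynomial ι k) (FractionRing (MvPolynomial ι k)) K :=
    FractionRing.isScalarTower_liftAlgebra _ K
  haveI : IsScalarTower k (FractionRing (MvPolynomial ι k)) K :=
    IsScalarTower.to₁₃₄ k (MvPolynomial ι k) (FractionRing (MvPolynomial ι k)) K
  haveI : Algebra.EssFiniteType (FractionRing (MvPolynomial ι k)) K :=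
    Algebra.EssFiniteType.of_comp k _ K
  haveI : CharZero (FractionRing (MvPolynomial ι k)) :=
    charZero_of_injective_algebraMap (algebraMap k _).injective
  haveI : Algebra.FormallySmooth (MvPolynomial ι k) (FractionRing (MvPolynomial ι k)) :=
    .of_isLocalization (nonZeroDivisors _)
  haveI : Algebra.FormallySmooth (MvPolynomial ι k) K :=
    .comp _ (FractionRing (MvPolynomial ι k)) _
  let ψ : MvPolynomial ι k →ₐ[k] TrivSqZeroExt K K :=
    aeval fun i => TrivSqZeroExt.inl (x i) + TrivSqZeroExt.inr (c i)
  let π : TrivSqZeroExt K K →ₐ[k] K := TrivSqZeroExt.fstHom k K K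
  obtain ⟨L, h1, h2⟩ := aux_lift (K := K) ψ.toRingHom π.toRingHom
    (fun y => ⟨TrivSqZeroExt.inl y, by simp [π]⟩)
    (fun a b ha hb => by
      have ha' : a.fst = 0 := ha
      have hb' : b.fst = 0 := hb
      ext <;> simp [ha', hb'])
    (fun a => by
      rw [hA]
      have : π.comp ψ = aeval x := by
        ext i; simp [π, ψ]
      exact DFunLike.congr_fun this a)
  have h1' : ∀ y, (L y).fst = y := h1
  have hk : ∀ r : k, L (algebraMap k K r) = algebraMap k _ r := by
    intro r
    rw [IsScalarTower.algebraMap_apply k (MvPolynomial ι k) K, h2]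
    exact ψ.commutes r
  refine ⟨Derivation.mk' { toFun := fun y => (L y).snd, map_add' := by simp, map_smul' := ?_ } ?_, ?_⟩
  · intro r y
    rw [Algebra.smul_def, map_mul, hk]
    simp [h1', Algebra.smul_def, TrivSqZeroExt.algebraMap_eq_inl']
  · intro a b
    simp [h1', mul_comm]
  · intro i
    have := h2 (X i)
    rw [hA, aeval_X] at this
    simp [this, ψ]

lemma der_chain {k A M σ : Type*} [Field k] [CommRing A] [Algebra k A] [AddCommGroup M]
    [Module k M] [Module A M] [Fintype σ]
    (D : Derivation k A M) (f : σ → A) (w : MvPolynomial σ k) :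
    D (aeval f w) = ∑ j, aeval f (pderiv j w) • D (f j) := by
  classical
  induction w using MvPolynomial.induction_on with
  | C a => simp
  | add p q hp hq => simp [hp, hq, add_smul, Finset.sum_add_distrib]
  | mul_X p i hp =>
    simp only [map_mul, aeval_X, Derivation.leibniz, hp, pderiv_X, smul_eq_mul, map_add, add_smul,
      Finset.sum_add_distrib, Finset.smul_sum, smul_smul]
    refine congrArg₂ _ ?_ rfl
    rw [Finset.sum_eq_single i]
    · simp
    · intro b _ hb
      simp [Pi.single_apply, hb.symm]
    · simp

lemma minors_zero_of_vec {K : Type*} [Field K] {m n : ℕ} (J : Matrix (Fin m) (Fin n) K)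
    (v : Fin m → K) (hv : v ≠ 0) (h : ∀ i, ∑ j, v j * J j i = 0) (i : Fin m → Fin n) :
    (Matrix.of fun j l => J j (i l)).det = 0 := by
  rw [← Matrix.exists_vecMul_eq_zero_iff]
  exact ⟨v, hv, by ext l; simpa [Matrix.vecMul, dotProduct] using h (i l)⟩

lemma vec_of_minors_zero {K : Type*} [Field K] {m n : ℕ} (J : Matrix (Fin m) (Fin n) K)
    (h : ∀ i : Fin m → Fin n, StrictMono i → (Matrix.of fun j l => J j (i l)).det = 0) :
    ∃ v : Fin m → K, v ≠ 0 ∧ ∀ i, ∑ j, v j * J j i = 0 := by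
  classical
  by_contra hcon
  push Not at hcon
  have hrow : LinearIndependent K J.row := by
    rw [Fintype.linearIndependent_iff]
    intro v hv
    by_contra hne
    push Not at hne
    obtain ⟨j, hj⟩ := hne
    obtain ⟨i, hi⟩ := hcon v (fun h0 => hj (by simp [h0]))
    apply hi
    have := congrFun hv i
    simpa [Matrix.row, Finset.sum_apply] using this
  have hr : J.rank = m := by simpa using hrow.rank_matrix
  obtain ⟨κ, a, ha, hsp, hli⟩ := exists_linearIndependent' K J.col
  haveI : Finite κ := Finite.of_injective a ha
  haveI : Fintype κ := Fintype.ofFinite κ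
  have hcard : Fintype.card κ = m := by
    rw [← hr, Matrix.rank_eq_finrank_span_cols, ← hsp]
    exact (finrank_span_eq_card hli).symm
  let s : Finset (Fin n) := Finset.univ.image a
  have hs : s.card = m := by
    rw [Finset.card_image_of_injective _ ha, Finset.card_univ, hcard]
  let i := s.orderEmbOfFin hs
  have hd := h i i.strictMono
  rw [← Matrix.exists_mulVec_eq_zero_iff] at hd
  obtain ⟨v, hv, hv0⟩ := hd
  have hmem : ∀ l, ∃ t, a t = i l := fun l => by
    have : i l ∈ s := s.orderEmbOfFin_mem hs l
    obtain ⟨t, -, ht⟩ := Finset.mem_image.1 this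
    exact ⟨t, ht⟩
  choose t ht using hmem
  have htinj : Function.Injective t := fun l l' hll => i.injective (by rw [← ht, ← ht, hll])
  have := hli.comp t htinj
  rw [Fintype.linearIndependent_iff] at this
  apply hv
  ext l
  refine this v ?_ l
  ext j
  have := congrFun hv0 j
  simp [Matrix.mulVec, dotProduct] at this
  simp only [Finset.sum_apply, Pi.smul_apply, smul_eq_mul, Pi.zero_apply]
  rw [← this]
  refine Finset.sum_congr rfl fun l _ => ?_
  rw [mul_comm, ← ht l]
  rfl

lemma pderiv_all_zero {k σ : Type*} [Field k] [CharZero k] (p : MvPolynomial σ k)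
    (h : ∀ j, pderiv j p = 0) : ∃ c, p = C c := by
  classical
  refine ⟨coeff 0 p, ?_⟩
  ext s
  rw [coeff_C]
  split_ifs with hs
  · rw [← hs]
  · obtain ⟨j, hj⟩ : ∃ j, s j ≠ 0 := by
      by_contra hc; push Not at hc
      exact hs (by ext j; simp [hc])
    have h1 := coeff_pderiv (i := j) p (s - Finsupp.single j 1)
    rw [h j] at h1
    have h2 : s - Finsupp.single j 1 + Finsupp.single j 1 = s := by
      ext l
      by_cases hl : j = l
      · subst hl; simp; omega
      · simp [Finsupp.single_apply, hl]
    rw [h2] at h1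
    have h3 : (((s - Finsupp.single j 1 : σ →₀ ℕ) j : ℕ) : k) + 1 ≠ 0 := Nat.cast_add_one_ne_zero _
    rw [coeff_zero] at h1
    rcases mul_eq_zero.1 h1.symm with h | h
    · exact h
    · exact absurd (by exact_mod_cast h) h3

lemma totalDegree_pderiv_lt' {k σ : Type*} [Field k] (p : MvPolynomial σ k) (j : σ)
    (h : pderiv j p ≠ 0) : (pderiv j p).totalDegree < p.totalDegree := by
  classical
  have key : ∀ s ∈ (pderiv j p).support, (s.sum fun _ e => e) + 1 ≤ p.totalDegree := by
    intro s hs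
    rw [mem_support_iff, coeff_pderiv] at hs
    have := le_totalDegree (mem_support_iff.2 (left_ne_zero_of_mul hs))
    rwa [Finsupp.sum_add_index' (by simp) (by simp), Finsupp.sum_single_index rfl] at this
  obtain ⟨s, hs⟩ := support_nonempty.2 h
  have h0 : 0 < p.totalDegree := lt_of_lt_of_le (Nat.succ_pos _) (key s hs)
  rw [totalDegree, Finset.sup_lt_iff (by simpa using h0)]
  intro b hb
  exact key b hb

lemma pderiv_comm' {k σ : Type*} [Field k] (p : MvPolynomial σ k) (i j : σ) :
    pderiv i (pderiv j p) = pderiv j (pderiv i p) := by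
  classical
  ext s
  rw [coeff_pderiv, coeff_pderiv, coeff_pderiv, coeff_pderiv]
  by_cases h : i = j
  · subst h; rfl
  · have h' : ¬ j = i := fun e => h e.symm
    simp [Finsupp.single_apply, h, h', add_right_comm s]
    ring

lemma bez_aux {S : Type*} [CommRing S] [IsDomain S] [UniqueFactorizationMonoid S]
    (U W : Polynomial S) (hU : Irreducible U) (hd : U.natDegree ≠ 0) (h : ¬ U ∣ W) :
    ∃ s : S, s ≠ 0 ∧ ∃ A B, Polynomial.C s = A * U + B * W := by
  classical
  letI := UniqueFactorizationMonoid.toGCDMonoid S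
  have hp := hU.isPrimitive hd
  have hU' := (hp.irreducible_iff_irreducible_map_fraction_map (K := FractionRing S)).1 hU
  have hn : ¬ U.map (algebraMap S (FractionRing S)) ∣ W.map (algebraMap S (FractionRing S)) :=
    fun hh => h (hp.dvd_of_fraction_map_dvd_fraction_map hh)
  obtain ⟨a, b, hab⟩ := (hU'.coprime_iff_not_dvd).2 hn
  obtain ⟨c, c0, hc⟩ := IsLocalization.integerNormalization_spec (nonZeroDivisors S) a
  obtain ⟨d, d0, hd⟩ := IsLocalization.integerNormalization_spec (nonZeroDivisors S) b
  rw [Algebra.smul_def, Polynomial.algebraMap_apply] at hc hd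
  rw [mem_nonZeroDivisors_iff_ne_zero] at c0 d0
  refine ⟨c * d, mul_ne_zero c0 d0,
    Polynomial.C d * IsLocalization.integerNormalization (nonZeroDivisors S) a,
    Polynomial.C c * IsLocalization.integerNormalization (nonZeroDivisors S) b, ?_⟩
  apply Polynomial.map_injective (algebraMap S (FractionRing S)) (IsFractionRing.injective _ _)
  simp only [Polynomial.map_add, Polynomial.map_mul, Polynomial.map_C, hc, hd, map_mul]
  linear_combination (-(Polynomial.C (algebraMap S (FractionRing S) c)) * (Polynomial.C (algebraMap S (FractionRing S) d))) * hab

lemma eis_aux {S : Type*} [CommRing S] [IsDomain S] [UniqueFactorizationMonoid S]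
    (U : Polynomial S) (hU : Irreducible U) (hd : U.natDegree ≠ 0) (a q : S) (ha : a ≠ 0)
    (hq : Prime q) (hqa : ¬ q ∣ a) :
    Irreducible (Polynomial.C a ^ 2 * (Polynomial.X ^ (2 * U.natDegree + 1) + Polynomial.C q)
      + Polynomial.C (q ^ 2) * U ^ 2) := by
  classical
  set N := 2 * U.natDegree + 1 with hN
  set F := Polynomial.C a ^ 2 * (Polynomial.X ^ N + Polynomial.C q)
      + Polynomial.C (q ^ 2) * U ^ 2 with hF
  have hU2 : (U ^ 2).natDegree < N := by rw [Polynomial.natDegree_pow]; omega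
  have hcoef : ∀ t, F.coeff t = a ^ 2 * ((if t = N then 1 else 0) + (if t = 0 then q else 0))
      + q ^ 2 * (U ^ 2).coeff t := by
    intro t
    rw [hF, ← Polynomial.C_pow, Polynomial.coeff_add, Polynomial.coeff_C_mul,
      Polynomial.coeff_C_mul, Polynomial.coeff_add, Polynomial.coeff_X_pow, Polynomial.coeff_C]
  have hFN : F.coeff N = a ^ 2 := by
    rw [hcoef, Polynomial.coeff_eq_zero_of_natDegree_lt hU2]; simp [hN]
  have hle : F.natDegree ≤ N := by
    rw [Polynomial.natDegree_le_iff_coeff_eq_zero]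
    intro t ht
    rw [hcoef, Polynomial.coeff_eq_zero_of_natDegree_lt (hU2.trans ht), if_neg (by omega),
      if_neg (by omega)]
    simp
  have hdeg : F.natDegree = N :=
    le_antisymm hle (Polynomial.le_natDegree_of_ne_zero (by rw [hFN]; exact pow_ne_zero _ ha))
  have hF0 : F ≠ 0 := by rintro h; rw [h] at hdeg; simp [hN] at hdeg
  have hqa2 : ¬ q ∣ a ^ 2 := fun h => hqa (hq.dvd_of_dvd_pow h)
  refine Polynomial.irreducible_of_eisenstein_criterion (P := Ideal.span {q})
    ((Ideal.span_singleton_prime hq.ne_zero).2 hq) ?_ ?_ ?_ ?_ ?_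
  · rw [Polynomial.leadingCoeff, hdeg, hFN, Ideal.mem_span_singleton]; exact hqa2
  · intro t ht
    rw [Polynomial.degree_eq_natDegree hF0, hdeg] at ht
    have ht' : t < N := by exact_mod_cast ht
    rw [Ideal.mem_span_singleton, hcoef, if_neg ht'.ne]
    refine dvd_add (Dvd.dvd.mul_left ?_ _) (Dvd.dvd.mul_right (dvd_pow_self q two_ne_zero) _)
    split_ifs <;> simp
  · rw [Polynomial.degree_eq_natDegree hF0, hdeg]; exact_mod_cast Nat.succ_pos _
  · rw [Ideal.span_singleton_pow, Ideal.mem_span_singleton, hcoef, if_neg (by omega), if_pos rfl]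
    intro h
    rw [dvd_add_left (dvd_mul_right _ _), zero_add, pow_two q, mul_dvd_mul_iff_right hq.ne_zero] at h
    exact hqa2 h
  · rw [Polynomial.isPrimitive_iff_isUnit_of_C_dvd]
    intro r hr
    rw [Polynomial.C_dvd_iff_dvd_coeff] at hr
    by_contra hru
    have hra := hr N
    rw [hFN] at hra
    have hr0 : r ≠ 0 := by rintro rfl; exact pow_ne_zero 2 ha (zero_dvd_iff.1 hra)
    obtain ⟨p, hp, hpr⟩ := WfDvdMonoid.exists_irreducible_factor hru hr0
    have hpp : Prime p := UniqueFactorizationMonoid.irreducible_iff_prime.1 hp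
    have hpa : p ∣ a := hpp.dvd_of_dvd_pow (hpr.trans hra)
    have hpq : ¬ p ∣ q := fun h => hqa (((hp.associated_of_dvd hq.irreducible h).symm.dvd).trans hpa)
    have hpU : Polynomial.C p ∣ U ^ 2 := by
      rw [Polynomial.C_dvd_iff_dvd_coeff]
      intro t
      have h1 := hpr.trans (hr t)
      rw [hcoef, dvd_add_right ((dvd_pow hpa two_ne_zero).mul_right _)] at h1
      exact (hpp.dvd_or_dvd h1).resolve_left fun h => hpq (hpp.dvd_of_dvd_pow h)
    have hpU' := (Polynomial.prime_C_iff.2 hpp).dvd_of_dvd_pow hpU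
    exact hpp.not_unit ((Polynomial.isPrimitive_iff_isUnit_of_C_dvd.1 (hU.isPrimitive hd)) p hpU')

noncomputable def eT (k : Type*) [Field k] {m : ℕ} (j : Fin m) :
    MvPolynomial (Fin m) k ≃ₐ[k] Polynomial (MvPolynomial {i // i ≠ j} k) :=
  (renameEquiv k (Equiv.optionSubtypeNe j).symm).trans (optionEquivLeft k _)

lemma eT_X_self {k : Type*} [Field k] {m : ℕ} (j : Fin m) : eT k j (X j) = Polynomial.X := by
  simp [eT]

lemma eT_X_ne {k : Type*} [Field k] {m : ℕ} (j i : Fin m) (h : i ≠ j) :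
    eT k j (X i) = Polynomial.C (X ⟨i, h⟩) := by
  simp [eT, Equiv.optionSubtypeNe_symm_of_ne h]

lemma eT_C {k : Type*} [Field k] {m : ℕ} (j : Fin m) (c : k) :
    eT k j (C c) = Polynomial.C (C c) := by
  simp [eT]

lemma eT_pderiv {k : Type*} [Field k] {m : ℕ} (j : Fin m) (p : MvPolynomial (Fin m) k) :
    eT k j (pderiv j p) = Polynomial.derivative (eT k j p) := by
  classical
  induction p using MvPolynomial.induction_on with
  | C a => simp [eT_C]
  | add p q hp hq => simp [hp, hq]
  | mul_X p i hp =>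
    by_cases h : i = j
    · subst h
      simp [Derivation.leibniz, hp, eT_X_self, mul_comm, add_comm]
    · simp [Derivation.leibniz, hp, eT_X_ne j i h, pderiv_X_of_ne h, mul_comm]

lemma eT_zero_iff {k : Type*} [Field k] [CharZero k] {m : ℕ} (j : Fin m)
    (p : MvPolynomial (Fin m) k) : pderiv j p = 0 ↔ (eT k j p).natDegree = 0 := by
  rw [← map_eq_zero_iff (eT k j) (eT k j).injective, eT_pderiv]
  constructor
  · exact Polynomial.natDegree_eq_zero_of_derivative_eq_zero
  · exact Polynomial.derivative_of_natDegree_zero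

lemma bez {k : Type*} [Field k] [CharZero k] {m : ℕ} (j : Fin m) (u w : MvPolynomial (Fin m) k)
    (hu : Irreducible u) (hj : pderiv j u ≠ 0) (h : ¬ u ∣ w) :
    ∃ a, a ≠ 0 ∧ pderiv j a = 0 ∧ ∃ A B, a = A * u + B * w := by
  obtain ⟨s, hs, A, B, hAB⟩ := bez_aux (eT k j u) (eT k j w)
    ((MulEquiv.irreducible_iff (eT k j)).2 hu) (fun h0 => hj ((eT_zero_iff j u).2 h0))
    (fun hh => h ((map_dvd_iff (eT k j)).1 hh))
  refine ⟨(eT k j).symm (Polynomial.C s), by simpa using hs, ?_, (eT k j).symm A,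
    (eT k j).symm B, ?_⟩
  · rw [eT_zero_iff]; simp
  · rw [hAB]; simp

lemma eis {k : Type*} [Field k] [CharZero k] {m : ℕ} (j : Fin m) (u a : MvPolynomial (Fin m) k)
    (hu : Irreducible u) (hj : pderiv j u ≠ 0) (ha : a ≠ 0) (haj : pderiv j a = 0)
    (hau : ¬ IsUnit a) :
    ∃ w, Irreducible w ∧ ∃ A B, w = a ^ 2 * A + u ^ 2 * B := by
  obtain ⟨s, hs⟩ : ∃ s, eT k j a = Polynomial.C s :=
    ⟨_, Polynomial.eq_C_of_natDegree_eq_zero ((eT_zero_iff j a).1 haj)⟩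
  have hs0 : s ≠ 0 := by
    rintro rfl
    rw [map_zero] at hs
    exact ha ((eT k j).map_eq_zero_iff.1 hs)
  have hsu : ¬ IsUnit s := fun h => hau ((MulEquiv.isUnit_map (eT k j)).1 (hs ▸ h.map Polynomial.C))
  have hs1 : ¬ IsUnit (s + 1) := by
    intro h
    obtain ⟨c, hc, hc2⟩ := MvPolynomial.isUnit_iff_eq_C_of_isReduced.1 h
    have : s = C (c - 1) := by rw [map_sub, ← hc2]; simp
    apply hsu
    rw [this]
    refine (IsUnit.mk0 _ ?_).map C
    intro h0
    exact hs0 (by rw [this, h0, map_zero])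
  have hs10 : s + 1 ≠ 0 := by
    intro h
    exact hsu (by rw [eq_neg_of_add_eq_zero_left h]; exact isUnit_one.neg)
  obtain ⟨q, hq, hqs⟩ := WfDvdMonoid.exists_irreducible_factor hs1 hs10
  have hqs' : ¬ q ∣ s := fun h => hq.not_isUnit (isUnit_of_dvd_one ((dvd_add_right h).1 hqs))
  have := eis_aux (eT k j u) ((MulEquiv.irreducible_iff (eT k j)).2 hu)
    (fun h0 => hj ((eT_zero_iff j u).2 h0)) s q hs0
    (UniqueFactorizationMonoid.irreducible_iff_prime.1 hq) hqs'
  rw [← hs] at this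
  refine ⟨_, (MulEquiv.irreducible_iff (eT k j).symm).2 this, 
    (eT k j).symm (Polynomial.X ^ (2 * ((eT k j) u).natDegree + 1) + Polynomial.C q),
    (eT k j).symm (Polynomial.C (q ^ 2)), ?_⟩
  rw [map_add, map_mul, map_mul, map_pow _ (eT k j a), map_pow _ (eT k j u),
    AlgEquiv.symm_apply_apply, AlgEquiv.symm_apply_apply, mul_comm (u ^ 2)]

lemma pderiv_zero_of_dvd {k : Type*} [Field k] [CharZero k] {m : ℕ} (j : Fin m)
    (u b : MvPolynomial (Fin m) k) (h : u ∣ b) (hb : b ≠ 0) (hbj : pderiv j b = 0) :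
    pderiv j u = 0 := by
  rw [eT_zero_iff] at *
  have := Polynomial.natDegree_le_of_dvd ((map_dvd_iff (eT k j)).2 h)
    (by rwa [Ne, map_eq_zero_iff (eT k j) (eT k j).injective])
  omega

lemma exists_pderiv_notMem {k : Type*} [Field k] [CharZero k] {m : ℕ}
    (P : Ideal (MvPolynomial (Fin m) k)) (hP : P ≠ ⊤) (a : MvPolynomial (Fin m) k) (ha : a ∈ P)
    (ha0 : a ≠ 0)
    (hmin : ∀ l, pderiv l a ∈ P → pderiv l a ≠ 0 → a.totalDegree ≤ (pderiv l a).totalDegree) :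
    ∃ l, pderiv l a ∉ P := by
  by_contra hcon
  push Not at hcon
  have hz : ∀ l, pderiv l a = 0 := by
    intro l
    by_contra hl
    have := hmin l (hcon l) hl
    have := totalDegree_pderiv_lt' a l hl
    omega
  obtain ⟨c, rfl⟩ := pderiv_all_zero a hz
  have hc : c ≠ 0 := by rintro rfl; simp at ha0
  exact hP (Ideal.eq_top_of_isUnit_mem _ ha ((IsUnit.mk0 c hc).map C))

lemma exists_min (k : Type*) [Field k] {m : ℕ} (Q : MvPolynomial (Fin m) k → Prop) (h : ∃ a, Q a) :
    ∃ a, Q a ∧ ∀ b, Q b → a.totalDegree ≤ b.totalDegree := by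
  classical
  have h' : ∃ d, ∃ a, Q a ∧ a.totalDegree = d := by
    obtain ⟨a, ha⟩ := h; exact ⟨_, a, ha, rfl⟩
  obtain ⟨a, ha, hd⟩ := Nat.find_spec h'
  exact ⟨a, ha, fun b hb => hd ▸ Nat.find_min' h' ⟨b, hb, rfl⟩⟩

lemma dichotomy {k : Type*} [Field k] [CharZero k] {m : ℕ}
    (P : Ideal (MvPolynomial (Fin m) k)) (hP : P.IsPrime) (hne : ∃ a ∈ P, a ≠ 0) :
    ∃ u ∈ P, Irreducible u ∧ ∃ j, pderiv j u ∉ P ∧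
      ((∀ w ∈ P, u ∣ w) ∨ ∃ a ∈ P, a ≠ 0 ∧ pderiv j a = 0 ∧ ∃ l, pderiv l a ∉ P) := by
  obtain ⟨u0, ⟨h0P, h00⟩, hmin⟩ := exists_min k (fun a => a ∈ P ∧ a ≠ 0) hne
  obtain ⟨u, hu, huP, hu0⟩ : ∃ u, Irreducible u ∧ u ∈ P ∧ u ∣ u0 := by
    have hf := UniqueFactorizationMonoid.exists_prime_factors u0 h00
    obtain ⟨s, hs, hass⟩ := hf
    have hm : s.prod ∈ P := by
      obtain ⟨t, ht⟩ := hass.symm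
      rw [← ht]; exact P.mul_mem_right _ h0P
    obtain ⟨u, hus, huP⟩ := (Ideal.IsPrime.multiset_prod_mem_iff_exists_mem hP s).1 hm
    exact ⟨u, (hs u hus).irreducible, huP, (Multiset.dvd_prod hus).trans hass.dvd⟩
  have hdeg : u.totalDegree ≤ u0.totalDegree := by
    obtain ⟨t, rfl⟩ := hu0
    rw [MvPolynomial.totalDegree_mul_of_isDomain (left_ne_zero_of_mul h00) (right_ne_zero_of_mul h00)]
    omega
  obtain ⟨j, hj⟩ := exists_pderiv_notMem P hP.ne_top u huP hu.ne_zero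
    (fun l h1 h2 => hdeg.trans (hmin _ ⟨h1, h2⟩))
  refine ⟨u, huP, hu, j, hj, ?_⟩
  by_cases hall : ∀ w ∈ P, u ∣ w
  · exact Or.inl hall
  · right
    push Not at hall
    obtain ⟨w, hw, huw⟩ := hall
    obtain ⟨a, ha0, haj, A, B, hAB⟩ := bez j u w hu (fun h => hj (h ▸ P.zero_mem)) huw
    have haP : a ∈ P := hAB ▸ P.add_mem (P.mul_mem_left _ huP) (P.mul_mem_left _ hw)
    obtain ⟨b, ⟨hbP, hb0, hbj⟩, hbmin⟩ := exists_min k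
      (fun a => a ∈ P ∧ a ≠ 0 ∧ pderiv j a = 0) ⟨a, haP, ha0, haj⟩
    refine ⟨b, hbP, hb0, hbj, ?_⟩
    refine exists_pderiv_notMem P hP.ne_top b hbP hb0 (fun l h1 h2 => hbmin _ ⟨h1, h2, ?_⟩)
    rw [pderiv_comm', hbj, map_zero]

lemma keyid {k : Type*} [Field k] {m n : ℕ} (f : Fin m → MvPolynomial (Fin n) k)
    (g : MvPolynomial (Fin n) k) {K : Type*} [Field K] [Algebra k K]
    (φ : MvPolynomial (Fin n) k →ₐ[k] K) (hg : φ g = 0)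
    (u : MvPolynomial (Fin m) k) (h : MvPolynomial (Fin n) k) (hu : aeval f u = g * h) (i : Fin n) :
    ∑ j, φ (aeval f (pderiv j u)) * φ (pderiv i (f j)) = φ h * φ (pderiv i g) := by
  have h1 := der_chain (pderiv i) f u
  have h2 := congrArg φ h1
  rw [hu, map_sum] at h2
  simp only [Derivation.leibniz, smul_eq_mul, map_add, map_mul, hg, zero_mul, zero_add] at h2
  exact h2.symm

lemma propA {k : Type*} [Field k] [CharZero k] {m n : ℕ} (f : Fin m → MvPolynomial (Fin n) k)
    (hf : AlgebraicIndependent k f)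
    (g : MvPolynomial (Fin n) k) {K : Type*} [Field K] [Algebra k K]
    (φ : MvPolynomial (Fin n) k →ₐ[k] K) (hφ : ∀ r, φ r = 0 ↔ g ∣ r)
    (w : MvPolynomial (Fin m) k) (hw : Irreducible w) (hgw : g ^ 2 ∣ aeval f w) :
    ∃ v : Fin m → K, v ≠ 0 ∧ ∀ i, ∑ j, v j * φ (pderiv i (f j)) = 0 := by
  have hg : φ g = 0 := (hφ g).2 dvd_rfl
  let Φ : MvPolynomial (Fin m) k →ₐ[k] K := φ.comp (aeval f)
  have hΦ : ∀ p, Φ p = φ (aeval f p) := fun p => rfl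
  have hP : (RingHom.ker Φ).IsPrime := RingHom.ker_isPrime Φ
  have hwP : w ∈ RingHom.ker Φ := by
    rw [RingHom.mem_ker, hΦ, hφ]; exact (dvd_pow_self g two_ne_zero).trans hgw
  obtain ⟨u, huP, hu, j, hj, h⟩ := dichotomy _ hP ⟨w, hwP, hw.ne_zero⟩
  rw [RingHom.mem_ker, hΦ] at huP hj
  rcases h with h | ⟨a, haP, ha0, haj, l, hl⟩
  · obtain ⟨c, hc⟩ := h w hwP
    have hcu : IsUnit c := (hw.isUnit_or_isUnit hc).resolve_left hu.not_isUnit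
    obtain ⟨t, ht⟩ : g ^ 2 ∣ aeval f u := by
      rw [hc, map_mul] at hgw
      exact ((hcu.map (aeval f)).dvd_mul_right).1 hgw
    refine ⟨fun j => φ (aeval f (pderiv j u)), fun h0 => hj (congrFun h0 j), fun i => ?_⟩
    rw [keyid f g φ hg u (g * t) (by rw [ht]; ring), map_mul, hg]; simp
  · rw [RingHom.mem_ker, hΦ] at haP hl
    obtain ⟨h, hh⟩ := (hφ _).1 huP
    obtain ⟨h', hh'⟩ := (hφ _).1 haP
    have k1 := keyid f g φ hg u h hh
    have k2 := keyid f g φ hg a h' hh'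
    by_cases hz : φ h' = 0
    · refine ⟨fun j => φ (aeval f (pderiv j a)), fun h0 => hl (congrFun h0 l), fun i => ?_⟩
      rw [k2, hz, zero_mul]
    · refine ⟨fun j => φ h' * φ (aeval f (pderiv j u)) - φ h * φ (aeval f (pderiv j a)),
        fun h0 => ?_, fun i => ?_⟩
      · have := congrFun h0 j
        simp only [haj, map_zero, mul_zero, sub_zero, Pi.zero_apply] at this
        exact (mul_ne_zero hz hj) this
      · simp only [sub_mul, Finset.sum_sub_distrib, mul_assoc, ← Finset.mul_sum, k1, k2]
        ring

lemma propB {k : Type*} [Field k] [CharZero k] {m n : ℕ} (f : Fin m → MvPolynomial (Fin n) k)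
    (g : MvPolynomial (Fin n) k) (hgi : Irreducible g) {K : Type*} [Field K] [Algebra k K]
    [Algebra.EssFiniteType k K]
    (φ : MvPolynomial (Fin n) k →ₐ[k] K) (hφ : ∀ r, φ r = 0 ↔ g ∣ r)
    (v : Fin m → K) (hv : v ≠ 0) (hvJ : ∀ i, ∑ j, v j * φ (pderiv i (f j)) = 0) :
    ∃ w : MvPolynomial (Fin m) k, Irreducible w ∧ g ^ 2 ∣ aeval f w := by
  classical
  have hg : φ g = 0 := (hφ g).2 dvd_rfl
  let Φ : MvPolynomial (Fin m) k →ₐ[k] K := φ.comp (aeval f)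
  have hΦ : ∀ p, Φ p = φ (aeval f p) := fun p => rfl
  have hΦ' : Φ = aeval (fun j => φ (f j)) := by ext i; simp [Φ]
  have hP : (RingHom.ker Φ).IsPrime := RingHom.ker_isPrime Φ
  have hD : ∀ D : Derivation k K K, ∑ j, v j * D (φ (f j)) = 0 := by
    intro D
    have h1 : ∀ r, D (φ r) = ∑ i, φ (pderiv i r) * D (φ (X i)) := by
      intro r
      have hh : φ = aeval (fun i => φ (X i)) := by ext i; simp
      have := der_chain D (fun i => φ (X i)) r
      rw [← hh] at this
      simpa using this
    have h2 : ∀ j, v j * D (φ (f j)) = ∑ i, v j * (φ (pderiv i (f j)) * D (φ (X i))) := by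
      intro j
      rw [h1 (f j), Finset.mul_sum]
    rw [Finset.sum_congr rfl fun j _ => h2 j, Finset.sum_comm]
    refine Finset.sum_eq_zero fun i _ => ?_
    simp_rw [← mul_assoc, ← Finset.sum_mul, hvJ, zero_mul]
  obtain ⟨j0, hj0⟩ : ∃ j, v j ≠ 0 := by
    by_contra hc; push Not at hc; exact hv (funext hc)
  have hne : ∃ a ∈ RingHom.ker Φ, a ≠ 0 := by
    by_contra hcon
    push Not at hcon
    have hind : AlgebraicIndependent k (fun j => φ (f j)) := by
      rw [algebraicIndependent_iff]
      intro p hp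
      exact hcon p (by rw [RingHom.mem_ker, hΦ']; exact hp)
    obtain ⟨D, hDx⟩ := exists_der _ hind (Pi.single j0 1)
    have := hD D
    simp only [hDx] at this
    simp [Pi.single_apply] at this
    exact hj0 this
  obtain ⟨u, huP, hu, j, hj, h⟩ := dichotomy _ hP hne
  have hju : pderiv j u ≠ 0 := fun h => hj (h ▸ Ideal.zero_mem _)
  rcases h with h | ⟨a, haP, ha0, haj, -⟩
  · refine ⟨u, hu, ?_⟩
    rw [RingHom.mem_ker, hΦ] at huP hj
    obtain ⟨t, ht⟩ := (hφ _).1 huP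
    have k1 := keyid f g φ hg u t ht
    have hind : AlgebraicIndependent k (fun p : {p // p ≠ j} => φ (f p)) := by
      rw [algebraicIndependent_iff]
      intro p hp
      by_contra hp0
      have h1 : rename Subtype.val p ∈ RingHom.ker Φ := by
        rw [RingHom.mem_ker, hΦ', aeval_rename]; exact hp
      have h2 : rename Subtype.val p ≠ 0 := fun h =>
        hp0 (rename_injective _ Subtype.val_injective (by rw [h, map_zero]))
      refine hju (pderiv_zero_of_dvd j u _ (h _ h1) h2 ?_)
      apply pderiv_eq_zero_of_notMem_vars
      intro hmem
      have := vars_rename _ _ hmem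
      simp at this
    -- v is proportional to the gradient of u
    have hprop : ∀ l, v l * φ (aeval f (pderiv j u)) = v j * φ (aeval f (pderiv l u)) := by
      intro l
      by_cases hlj : l = j
      · rw [hlj]
      obtain ⟨D, hDx⟩ := exists_der _ hind (Pi.single ⟨l, hlj⟩ 1)
      have hDl : D (φ (f l)) = 1 := by have := hDx ⟨l, hlj⟩; simpa using this
      have hDp : ∀ p, p ≠ j → p ≠ l → D (φ (f p)) = 0 := by
        intro p hp hpl
        have := hDx ⟨p, hp⟩
        simpa [Pi.single_apply, hpl] using this
      have hsum : ∀ c : Fin m → K, ∑ p, c p * D (φ (f p)) = c l + c j * D (φ (f j)) := by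
        intro c
        rw [← Finset.sum_subset (Finset.subset_univ {l, j}), Finset.sum_pair hlj, hDl, mul_one]
        intro p _ hp
        simp only [Finset.mem_insert, Finset.mem_singleton, not_or] at hp
        rw [hDp p hp.2 hp.1, mul_zero]
      have e1 := hD D
      rw [hsum] at e1
      have e2 := der_chain D (fun j => φ (f j)) u
      rw [← hΦ', hΦ, huP, map_zero] at e2
      simp only [smul_eq_mul, hΦ] at e2
      rw [hsum (fun p => φ (aeval f (pderiv p u)))] at e2
      linear_combination φ (aeval f (pderiv j u)) * e1 + v j * e2
    have hvj : v j ≠ 0 := by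
      intro h0
      have := hprop j0
      rw [h0, zero_mul] at this
      exact mul_ne_zero hj0 hj this
    have hz : ∀ i, φ t * φ (pderiv i g) = 0 := by
      intro i
      have e : v j * (φ t * φ (pderiv i g)) = 0 := by
        rw [← k1, Finset.mul_sum]
        simp_rw [← mul_assoc, ← hprop]
        have := hvJ i
        calc _ = φ (aeval f (pderiv j u)) * ∑ j, v j * φ (pderiv i (f j)) := by
              rw [Finset.mul_sum]; exact Finset.sum_congr rfl fun _ _ => by ring
          _ = 0 := by rw [this, mul_zero]
      exact (mul_eq_zero.1 e).resolve_left hvj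
    have ht0 : φ t = 0 := by
      by_contra hne
      have hz' : ∀ i, pderiv i g = 0 := by
        intro i
        by_contra hi
        obtain ⟨r, hr⟩ := (hφ _).1 ((mul_eq_zero.1 (hz i)).resolve_left hne)
        have h1 := totalDegree_pderiv_lt' g i hi
        rw [hr] at hi h1
        rw [MvPolynomial.totalDegree_mul_of_isDomain (left_ne_zero_of_mul hi)
          (right_ne_zero_of_mul hi)] at h1
        omega
      obtain ⟨c, rfl⟩ := pderiv_all_zero g hz'
      refine hgi.not_isUnit ((IsUnit.mk0 c ?_).map C)
      rintro rfl
      exact hgi.ne_zero (map_zero _)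
    rw [ht, pow_two]
    exact mul_dvd_mul_left _ ((hφ t).1 ht0)
  · have hau : ¬ IsUnit a := fun h => hP.ne_top (Ideal.eq_top_of_isUnit_mem _ haP h)
    obtain ⟨w, hw, A, B, hAB⟩ := eis j u a hu hju ha0 haj hau
    refine ⟨w, hw, ?_⟩
    rw [RingHom.mem_ker, hΦ, hφ] at haP huP
    rw [hAB]
    simp only [map_add, map_mul, map_pow]
    exact dvd_add ((pow_dvd_pow_of_dvd haP 2).mul_right _) ((pow_dvd_pow_of_dvd huP 2).mul_right _)

universe u in
lemma exists_field {k : Type u} [Field k] {n : ℕ} (g : MvPolynomial (Fin n) k)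
    (hg : Irreducible g) : ∃ (K : Type u) (_ : Field K) (_ : Algebra k K)
      (_ : Algebra.EssFiniteType k K) (φ : MvPolynomial (Fin n) k →ₐ[k] K),
      ∀ r, φ r = 0 ↔ g ∣ r := by
  have hp : Prime g := UniqueFactorizationMonoid.irreducible_iff_prime.1 hg
  haveI : (Ideal.span {g}).IsPrime := (Ideal.span_singleton_prime hp.ne_zero).2 hp
  let Q := MvPolynomial (Fin n) k ⧸ Ideal.span {g}
  haveI : Algebra.EssFiniteType Q (FractionRing Q) :=
    Algebra.EssFiniteType.of_isLocalization _ (nonZeroDivisors Q)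
  haveI : Algebra.EssFiniteType k (FractionRing Q) := Algebra.EssFiniteType.comp k Q _
  refine ⟨FractionRing Q, inferInstance, inferInstance, inferInstance,
    (IsScalarTower.toAlgHom k Q (FractionRing Q)).comp (Ideal.Quotient.mkₐ k _), fun r => ?_⟩
  rw [← Ideal.mem_span_singleton, ← Ideal.Quotient.eq_zero_iff_mem]
  exact map_eq_zero_iff (algebraMap Q (FractionRing Q)) (IsFractionRing.injective _ _)

lemma map_jacDet {k : Type*} [Field k] {m n : ℕ} (f : Fin m → MvPolynomial (Fin n) k)
    {K : Type*} [Field K] [Algebra k K] (φ : MvPolynomial (Fin n) k →ₐ[k] K)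
    (i : Fin m → Fin n) :
    φ (jacDet f i) = (Matrix.of fun j l => φ (pderiv (i l) (f j))).det := by
  rw [jacDet, AlgHom.map_det]
  rfl

/-- For algebraically independent `f₁,…,f_m`, `dgcd(f₁,…,f_m) ∈ k ∖ {0}` iff
for every irreducible `w ∈ k[x₁,…,x_m]` the polynomial `w(f₁,…,f_m)` is
square-free in `k[x₁,…,xₙ]`. -/
theorem statement5 {k : Type*} [Field k] [CharZero k] {m n : ℕ}
    (hm : 1 ≤ m) (hmn : m ≤ n)
    (f : Fin m → MvPolynomial (Fin n) k)
    (hf : AlgebraicIndependent k f) :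
    (∃ c : k, c ≠ 0 ∧ IsDgcd f (C c)) ↔
      ∀ w : MvPolynomial (Fin m) k, Irreducible w → Squarefree (aeval f w) := by
  constructor
  · rintro ⟨c, hc, -, hgcd⟩ w hw b hb
    by_contra hbu
    have hw0 : aeval f w ≠ 0 := fun h0 =>
      hw.ne_zero ((algebraicIndependent_iff.1 hf) w h0)
    have hb0 : b ≠ 0 := by
      rintro rfl
      exact hw0 (zero_dvd_iff.1 (by simpa using hb))
    obtain ⟨g, hg, hgb⟩ := WfDvdMonoid.exists_irreducible_factor hbu hb0
    obtain ⟨K, _, _, _, φ, hφ⟩ := exists_field g hg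
    obtain ⟨v, hv, hvJ⟩ := propA f hf g φ hφ w hw
      ((by rw [pow_two]; exact mul_dvd_mul hgb hgb : g ^ 2 ∣ b * b).trans hb)
    have := hgcd g (fun i _ => by
      rw [← hφ, map_jacDet]
      exact minors_zero_of_vec (Matrix.of fun j l => φ (pderiv l (f j))) v hv hvJ i)
    exact hg.not_isUnit (isUnit_of_dvd_unit this ((IsUnit.mk0 c hc).map C))
  · intro h
    refine ⟨1, one_ne_zero, fun i _ => by simp, fun e he => ?_⟩
    rw [map_one]
    by_contra hcon
    obtain ⟨g, hg, hgJ⟩ : ∃ g : MvPolynomial (Fin n) k, Irreducible g ∧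
        ∀ i : Fin m → Fin n, StrictMono i → g ∣ jacDet f i := by
      by_cases he0 : e = 0
      · subst he0
        refine ⟨X ⟨0, by omega⟩, (X_prime).irreducible, fun i hi => ?_⟩
        rw [zero_dvd_iff.1 (he i hi)]
        exact dvd_zero _
      · obtain ⟨g, hg, hge⟩ := WfDvdMonoid.exists_irreducible_factor
          (fun hu => hcon hu.dvd) he0
        exact ⟨g, hg, fun i hi => hge.trans (he i hi)⟩
    obtain ⟨K, _, _, _, φ, hφ⟩ := exists_field g hg
    obtain ⟨v, hv, hvJ⟩ := vec_of_minors_zero (Matrix.of fun j l => φ (pderiv l (f j)))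
      (fun i hi => by
        have := (hφ _).2 (hgJ i hi)
        rw [map_jacDet] at this
        exact this)
    obtain ⟨w, hw, hgw⟩ := propB f g hg φ hφ v hv hvJ
    exact hg.not_isUnit (h w hw g (by rwa [← pow_two]))
end

section
/- Let k be a field of characteristic zero and let f_1,…,f_m ∈ k[x_1,…,x_n] be algebraically independent over k, with 1 ≤ m ≤ n. Then dgcd(f_1,…,f_m) is a nonzero element of k if and only if for every square-free polynomial w ∈ k[x_1,…,x_m] the polynomial w(f_1,…,f_m) is square-free in k[x_1,…,x_n]. -/
open MvPolynomial

theorem aux_chain {k : Type*} [Field k] {σ : Type*} [Fintype σ] {A M : Type*} [CommRing A] [Algebra k A]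
    [AddCommGroup M] [Module k M] [Module A M] [IsScalarTower k A M] (D : Derivation k A M) (f : σ → A)
    (w : MvPolynomial σ k) :
    D (aeval f w) = ∑ j, aeval f (pderiv j w) • D (f j) := by
  classical
  induction w using MvPolynomial.induction_on with
  | C a => simp
  | add p q hp hq => simp [hp, hq, add_smul, Finset.sum_add_distrib]
  | mul_X p i hp =>
    rw [map_mul, Derivation.leibniz, hp, aeval_X]
    simp only [pderiv_mul, map_add, map_mul, aeval_X, add_smul, Finset.sum_add_distrib, pderiv_X]
    rw [Finset.smul_sum, add_comm]
    congr 1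
    · refine Finset.sum_congr rfl fun j _ => ?_
      rw [smul_smul, mul_comm]
    · rw [Finset.sum_eq_single i]
      · simp
      · intro b _ hb
        simp [hb.symm]
      · simp

theorem aux_vars_of_pderiv {k : Type*} [Field k] [CharZero k] {σ : Type*}
    (p : MvPolynomial σ k) (i : σ) (h : pderiv i p = 0) : i ∉ p.vars := by
  classical
  intro hi
  obtain ⟨s, hs, hsi⟩ := (mem_vars_iff_mem_support i).mp hi
  have h1 := coeff_pderiv (i := i) p (s - Finsupp.single i 1)
  have hsi' : s i ≠ 0 := by simpa using hsi
  have h2 : s - Finsupp.single i 1 + Finsupp.single i 1 = s := by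
    ext j
    by_cases hj : i = j
    · subst hj; simp; omega
    · simp [hj]
  rw [h, h2] at h1
  have h3 : (((s - Finsupp.single i 1 : σ →₀ ℕ) i : ℕ) : k) + 1 ≠ 0 := Nat.cast_add_one_ne_zero _
  simp only [coeff_zero] at h1
  exact (mul_ne_zero (mem_support_iff.mp hs) h3) h1.symm

theorem aux_deg_pderiv {k : Type*} [Field k] {σ : Type*}
    (p : MvPolynomial σ k) (i : σ) (h : pderiv i p ≠ 0) :
    (pderiv i p).totalDegree < p.totalDegree := by
  classical
  obtain ⟨s, hs, hd⟩ := Finset.exists_mem_eq_sup (pderiv i p).support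
    (by simpa using h) (fun s => s.sum fun _ e => e)
  have : (pderiv i p).totalDegree = s.sum fun _ e => e := hd
  rw [this]
  have h1 : s + Finsupp.single i 1 ∈ p.support := by
    rw [mem_support_iff] at hs ⊢
    rw [coeff_pderiv] at hs
    exact left_ne_zero_of_mul hs
  have h2 := le_totalDegree h1
  rw [Finsupp.sum_add_index' (by simp) (by simp)] at h2
  simp at h2
  omega

theorem aux_not_dvd_pderiv {k : Type*} [Field k] {σ : Type*}
    (p : MvPolynomial σ k) (i : σ) (h : pderiv i p ≠ 0) : ¬ p ∣ pderiv i p := by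
  intro hd
  have := aux_deg_pderiv p i h
  have := totalDegree_le_of_dvd_of_isDomain hd h
  omega

theorem aux_exists_pderiv {k : Type*} [Field k] [CharZero k] {σ : Type*}
    (p : MvPolynomial σ k) (hp : Irreducible p) : ∃ i, pderiv i p ≠ 0 := by
  by_contra! h
  have h1 : p.vars = ∅ := Finset.eq_empty_of_forall_notMem fun i => aux_vars_of_pderiv p i (h i)
  rw [vars_eq_empty_iff_eq_C] at h1
  apply hp.not_isUnit
  rw [h1]
  refine IsUnit.map C (isUnit_iff_ne_zero.mpr fun h0 => hp.ne_zero ?_)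
  rw [h1, h0, C_0]

theorem aux_minor {L : Type*} [Field L] {m n : ℕ} (F : Matrix (Fin m) (Fin n) L) :
    (∀ i : Fin m → Fin n, StrictMono i → (F.submatrix id i).det = 0) ↔ ∃ c ≠ 0, Matrix.vecMul c F = 0 := by
  constructor
  · intro h
    by_contra! hc
    have hinj : Function.Injective F.vecMul := by
      rw [← Matrix.coe_vecMulLinear, injective_iff_map_eq_zero]
      intro a ha
      by_contra h0
      exact hc a h0 ha
    rw [Matrix.vecMul_injective_iff] at hinj
    have hr : F.rank = m := by simpa using hinj.rank_matrix
    have hsp : Module.finrank L (Submodule.span L (Set.range F.col)) = m := by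
      rw [← Matrix.rank_eq_finrank_span_cols, hr]
    obtain ⟨κ, a, ha, hsp', hli⟩ := exists_linearIndependent' L F.col
    have : Finite κ := Finite.of_injective a ha
    have := Fintype.ofFinite κ
    have hcard : Fintype.card κ = m := by
      rw [← hsp, ← hsp', finrank_span_eq_card hli]
    classical
    let s : Finset (Fin n) := Finset.univ.image a
    have hs : s.card = m := by
      rw [Finset.card_image_of_injective _ ha, Finset.card_univ, hcard]
    let i := s.orderEmbOfFin hs
    have hi : ∀ x, ∃ y, a y = i x := by
      intro x
      have h0 : i x ∈ s := s.orderEmbOfFin_mem hs x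
      obtain ⟨y, -, hy⟩ := Finset.mem_image.mp h0
      exact ⟨y, hy⟩
    choose e he using hi
    have hinj : Function.Injective e := by
      intro x y hxy
      apply i.injective
      rw [← he, ← he, hxy]
    have h1 := h i i.strictMono
    have h2 : LinearIndependent L (F.submatrix id i).col := by
      have h3 : (F.submatrix id i).col = (F.col ∘ a) ∘ e := by
        ext x y
        change F y (i x) = F y (a (e x))
        rw [he]
      rw [h3]
      exact hli.comp e hinj
    rw [Matrix.linearIndependent_cols_iff_isUnit, Matrix.isUnit_iff_isUnit_det, h1] at h2
    simp at h2
  · rintro ⟨c, hc, h⟩ i hi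
    rw [← Matrix.exists_vecMul_eq_zero_iff]
    refine ⟨c, hc, ?_⟩
    ext x
    exact congrFun h (i x)

theorem aux_surj {L : Type*} [Field L] {m n : ℕ} (F : Matrix (Fin m) (Fin n) L)
    (h : ¬ ∃ c ≠ 0, Matrix.vecMul c F = 0) (u : Fin m → L) : ∃ v, F.mulVec v = u := by
  classical
  rw [← aux_minor] at h
  push Not at h
  obtain ⟨i, hi, hd⟩ := h
  have hu : IsUnit (F.submatrix id i) := by
    rw [Matrix.isUnit_iff_isUnit_det]; exact isUnit_iff_ne_zero.mpr hd
  obtain ⟨v, hv⟩ := (Matrix.mulVec_surjective_iff_isUnit.mpr hu) u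
  refine ⟨fun l => ∑ x, if i x = l then v x else 0, ?_⟩
  rw [← hv]
  ext j
  simp only [Matrix.mulVec, dotProduct, Matrix.submatrix_apply, Finset.mul_sum, id]
  rw [Finset.sum_comm]
  simp

open scoped TensorProduct in
theorem aux_ext0 {k : Type*} [Field k] [CharZero k] {L : Type*} [Field L] [Algebra k L] {ι : Type*}
    (x : ι → L) (hx : IsTranscendenceBasis k x) (v : ι → L) :
    ∃ D : Derivation k L L, ∀ i, D (x i) = v i := by
  classical
  let R := MvPolynomial ι k
  let _ : Algebra R L := (aeval x : MvPolynomial ι k →ₐ[k] L).toRingHom.toAlgebra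
  have hmap : ∀ r : R, algebraMap R L r = aeval x r := fun _ => rfl
  have : IsScalarTower k R L := IsScalarTower.of_algebraMap_eq fun a => by
    rw [hmap]; simp [R, algebraMap_eq]
  have hinj : Function.Injective (algebraMap R L) := hx.1
  have : FaithfulSMul R L := (faithfulSMul_iff_algebraMap_injective R L).mpr hinj
  let K := FractionRing R
  let _ : Algebra K L := FractionRing.liftAlgebra R L
  have : IsScalarTower R K L := FractionRing.isScalarTower_liftAlgebra R L
  have halgR : Algebra.IsAlgebraic R L := by
    rw [hx.isAlgebraic_iff]
    intro i
    have h1 : x i = algebraMap R L (X i) := by rw [hmap]; simp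
    rw [h1]
    exact isAlgebraic_algebraMap _
  have : Algebra.IsAlgebraic K L := (IsFractionRing.comap_isAlgebraic_iff (A := R) (K := K) (C := L)).mp halgR
  have : CharZero R := inferInstanceAs (CharZero (MvPolynomial ι k))
  have : CharZero K := inferInstance
  have : Algebra.FormallyEtale K L := Algebra.FormallyEtale.of_isSeparable K L
  have : Algebra.FormallyEtale R K := Algebra.FormallyEtale.of_isLocalization (nonZeroDivisors R)
  have : Algebra.FormallyEtale R L := Algebra.FormallyEtale.comp R K L
  let d : Derivation k R L := mkDerivation k v
  let φ : L ⊗[R] Ω[R⁄k] →ₗ[L] L := LinearMap.liftBaseChange L d.liftKaehlerDifferential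
  let ψ := φ.comp (KaehlerDifferential.tensorKaehlerEquivOfFormallyEtale k R L).symm.toLinearMap
  refine ⟨ψ.compDer (KaehlerDifferential.D k L), fun i => ?_⟩
  have h1 : x i = algebraMap R L (X i) := by rw [hmap]; simp
  have h2 : d (X i) = v i := mkDerivation_X _ _ _
  rw [h1]
  simp [ψ, φ, KaehlerDifferential.tensorKaehlerEquivOfFormallyEtale_symm_D_algebraMap, h2]


theorem aux_ext {k : Type*} [Field k] [CharZero k] {L : Type*} [Field L] [Algebra k L] {ι : Type*}
    (x : ι → L) (hx : AlgebraicIndependent k x) (v : ι → L) :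
    ∃ D : Derivation k L L, ∀ i, D (x i) = v i := by
  classical
  obtain ⟨t, hst, ht⟩ := exists_isTranscendenceBasis_superset (AlgebraicIndependent.to_subtype_range hx)
  obtain ⟨D, hD⟩ := aux_ext0 _ ht (fun y => if h : ∃ i, x i = y then v h.choose else 0)
  refine ⟨D, fun i => ?_⟩
  have h1 := hD ⟨x i, hst ⟨i, rfl⟩⟩
  have h2 : ∃ j, x j = x i := ⟨i, rfl⟩
  simp only [h2, dif_pos] at h1
  rw [h1, hx.injective h2.choose_spec]

theorem aux_indep {k : Type*} [Field k] {L : Type*} [Field L] [Algebra k L] {σ : Type*}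
    (x : σ → L) (B : Set σ)
    (h : ∀ p : MvPolynomial σ k, (p.vars : Set σ) ⊆ B → aeval x p = 0 → p = 0) :
    AlgebraicIndependent k (fun i : B => x i) := by
  classical
  rw [algebraicIndependent_iff]
  intro p hp
  have h1 := h (rename Subtype.val p) ?_ ?_
  · exact (map_eq_zero_iff _ (rename_injective _ Subtype.val_injective)).mp h1
  · intro i hi
    have := vars_rename _ _ hi
    simp only [Finset.mem_image] at this
    obtain ⟨a, -, rfl⟩ := this
    exact a.2
  · rw [aeval_rename]; exact hp

theorem aux_gauss {k : Type*} [Field k] {L : Type*} [Field L] [Algebra k L] {σ : Type*} 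
    (x : σ → L) (i : σ) (hx : AlgebraicIndependent k (fun j : {j // j ≠ i} => x j))
    (p q : MvPolynomial σ k) (hp : Irreducible p) (hp0 : aeval x p = 0) (hq0 : aeval x q = 0) :
    p ∣ q := by
  classical
  let R := MvPolynomial {j // j ≠ i} k
  let _ : Algebra R L := (aeval (fun j : {j // j ≠ i} => x j) :
    MvPolynomial {j // j ≠ i} k →ₐ[k] L).toRingHom.toAlgebra
  have hmap : ∀ r : R, algebraMap R L r = aeval (fun j : {j // j ≠ i} => x j) r := fun _ => rfl
  have : IsScalarTower k R L := IsScalarTower.of_algebraMap_eq fun a => by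
    rw [hmap]; simp [R, algebraMap_eq]
  have hinj : Function.Injective (algebraMap R L) := hx
  have : FaithfulSMul R L := (faithfulSMul_iff_algebraMap_injective R L).mpr hinj
  let K := FractionRing R
  let _ : Algebra K L := FractionRing.liftAlgebra R L
  have : IsScalarTower R K L := FractionRing.isScalarTower_liftAlgebra R L
  let e : MvPolynomial σ k ≃ₐ[k] Polynomial R :=
    (renameEquiv k (Equiv.optionSubtypeNe i).symm).trans (optionEquivLeft k _)
  have he : ∀ r, Polynomial.aeval (x i) (e r) = aeval x r := by
    intro r
    induction r using MvPolynomial.induction_on with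
    | C a => 
      have : e (C a) = algebraMap k (Polynomial R) a := e.commutes a
      rw [this, IsScalarTower.algebraMap_apply k R (Polynomial R), Polynomial.algebraMap_eq,
        Polynomial.aeval_C, ← IsScalarTower.algebraMap_apply, aeval_C]
    | add p q hp hq => simp [hp, hq]
    | mul_X p j hp =>
      rw [map_mul, map_mul, hp, map_mul, aeval_X]
      congr 1
      by_cases hj : j = i
      · subst hj
        simp [e, R, optionEquivLeft_X_none]
      · have : (Equiv.optionSubtypeNe i).symm j = some ⟨j, hj⟩ := by simp [hj]
        have h2 : e (X j) = Polynomial.C (X ⟨j, hj⟩ : MvPolynomial {j // j ≠ i} k) := by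
          simp only [e, AlgEquiv.trans_apply, renameEquiv_apply, rename_X, this]
          exact optionEquivLeft_X_some _ _ _
        rw [h2]
        refine (Polynomial.aeval_C (R := R) (x i) (X ⟨j, hj⟩)).trans ?_
        rw [hmap]; exact aeval_X _ _
  have hpi : Irreducible (e p) := (MulEquiv.irreducible_iff e).mpr hp
  have hdeg : (e p).natDegree ≠ 0 := by
    intro h0
    have h1 := Polynomial.eq_C_of_natDegree_eq_zero h0
    have h2 := he p
    rw [hp0, h1, Polynomial.aeval_C] at h2
    have h3 := (map_eq_zero_iff _ hinj).mp h2
    rw [h3, Polynomial.C_0] at h1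
    exact hpi.ne_zero h1
  have hprim := hpi.isPrimitive hdeg
  have hK := (hprim.irreducible_iff_irreducible_map_fraction_map (K := K)).mp hpi
  have h1 : ∀ r, aeval x r = 0 → Polynomial.aeval (x i) ((e r).map (algebraMap R K)) = 0 := by
    intro r hr
    rw [Polynomial.aeval_map_algebraMap, he, hr]
  have hm1 := minpoly.dvd K _ (h1 q hq0)
  have hm2 := minpoly.dvd K _ (h1 p hp0)
  have hint : IsIntegral K (x i) := isAlgebraic_iff_isIntegral.mp ⟨_, hK.ne_zero, h1 p hp0⟩
  have hass : Associated (minpoly K (x i)) ((e p).map (algebraMap R K)) :=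
    (minpoly.irreducible hint).associated_of_dvd hK hm2
  have h2 : e p ∣ e q := hprim.dvd_of_fraction_map_dvd_fraction_map (K := K) (hass.symm.dvd.trans hm1)
  exact (map_dvd_iff e).mp h2

theorem aux_factor {k : Type*} [Field k] {L : Type*} [Field L] [Algebra k L] {σ : Type*}
    (x : σ → L) (q : MvPolynomial σ k) (hq : q ≠ 0) (h0 : aeval x q = 0) :
    ∃ p, Irreducible p ∧ p ∣ q ∧ aeval x p = 0 := by
  induction q using WfDvdMonoid.induction_on_irreducible with
  | zero => exact absurd rfl hq
  | unit u hu => exact absurd h0 (hu.map (aeval x)).ne_zero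
  | mul a i ha hi ih =>
    rw [map_mul, mul_eq_zero] at h0
    rcases h0 with h0 | h0
    · exact ⟨i, hi, dvd_mul_right _ _, h0⟩
    · obtain ⟨p, h1, h2, h3⟩ := ih ha h0
      exact ⟨p, h1, h2.mul_left _, h3⟩

/-- The reduced Jacobian matrix. -/
noncomputable def auxF {k : Type*} [Field k] {m n : ℕ} (L : Type*) [Field L]
    [Algebra (MvPolynomial (Fin n) k) L]
    (f : Fin m → MvPolynomial (Fin n) k) : Matrix (Fin m) (Fin n) L :=
  Matrix.of fun j l => algebraMap _ L (pderiv l (f j))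

theorem aux_der {k : Type*} [Field k] {n : ℕ} {L : Type*} [Field L] [Algebra k L]
    [Algebra (MvPolynomial (Fin n) k) L] [IsScalarTower k (MvPolynomial (Fin n) k) L]
    (D : Derivation k (MvPolynomial (Fin n) k) L) (a : MvPolynomial (Fin n) k) :
    D a = ∑ l, algebraMap _ L (pderiv l a) * D (X l) := by
  have := aux_chain D X a
  simpa [aeval_X_left, Algebra.smul_def] using this

theorem aux_der_comp {k : Type*} [Field k] {m n : ℕ} {L : Type*} [Field L] [Algebra k L]
    [Algebra (MvPolynomial (Fin n) k) L] [IsScalarTower k (MvPolynomial (Fin n) k) L]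
    (D : Derivation k (MvPolynomial (Fin n) k) L) (f : Fin m → MvPolynomial (Fin n) k)
    (w : MvPolynomial (Fin m) k) :
    D (aeval f w) = ∑ j, aeval (fun j => algebraMap _ L (f j)) (pderiv j w) * D (f j) := by
  rw [aux_chain D f w]
  refine Finset.sum_congr rfl fun j _ => ?_
  rw [Algebra.smul_def]
  congr 1
  exact (aeval_algebraMap_apply L f _).symm

theorem aux_pd {k : Type*} [Field k] {m n : ℕ} {L : Type*} [Field L] [Algebra k L]
    [Algebra (MvPolynomial (Fin n) k) L] [IsScalarTower k (MvPolynomial (Fin n) k) L]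
    (f : Fin m → MvPolynomial (Fin n) k)
    (w : MvPolynomial (Fin m) k) (l : Fin n) :
    algebraMap _ L (pderiv l (aeval f w)) =
      Matrix.vecMul (fun j => aeval (fun j => algebraMap _ L (f j)) (pderiv j w)) (auxF L f) l := by
  rw [aux_chain (pderiv l) f w, map_sum]
  refine Finset.sum_congr rfl fun j _ => ?_
  rw [smul_eq_mul, map_mul]
  congr 1
  exact (aeval_algebraMap_apply L f _).symm

theorem aux_alg {k : Type*} [Field k] [CharZero k] {m n : ℕ} {L : Type*} [Field L] [Algebra k L]
    [Algebra (MvPolynomial (Fin n) k) L] [IsScalarTower k (MvPolynomial (Fin n) k) L]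
    (D : Derivation k (MvPolynomial (Fin n) k) L) (f : Fin m → MvPolynomial (Fin n) k)
    (hD : ∀ a, algebraMap _ L a = 0 → D a = 0) (B : Set (Fin m)) (hB : ∀ b ∈ B, D (f b) = 0)
    (hI : ∀ p : MvPolynomial (Fin m) k, (p.vars : Set (Fin m)) ⊆ B →
      aeval (fun j => algebraMap _ L (f j)) p = 0 → p = 0)
    (a : Fin m)
    (ha : ∃ p : MvPolynomial (Fin m) k, (p.vars : Set (Fin m)) ⊆ insert a B ∧
      aeval (fun j => algebraMap _ L (f j)) p = 0 ∧ p ≠ 0) : D (f a) = 0 := by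
  classical
  obtain ⟨N, hN⟩ : ∃ N, ∃ p : MvPolynomial (Fin m) k, p.totalDegree = N ∧
    (p.vars : Set (Fin m)) ⊆ insert a B ∧
      aeval (fun j => algebraMap _ L (f j)) p = 0 ∧ p ≠ 0 := by
    obtain ⟨p, hp⟩ := ha
    exact ⟨_, p, rfl, hp⟩
  induction N using Nat.strong_induction_on with
  | _ N ih =>
    obtain ⟨p, hpN, hpv, hp0, hpne⟩ := hN
    have hda : pderiv a p ≠ 0 := by
      intro h
      refine hpne (hI p (fun i hi => ?_) hp0)
      rcases hpv hi with h' | h'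
      · subst h'
        exact absurd hi (aux_vars_of_pderiv p i h)
      · exact h'
    by_cases h1 : aeval (fun j => algebraMap _ L (f j)) (pderiv a p) = 0
    · refine ih _ ?_ ⟨pderiv a p, rfl, ?_, h1, hda⟩
      · rw [← hpN]; exact aux_deg_pderiv p a hda
      · intro i hi
        obtain ⟨s, hs, hsi⟩ := (mem_vars_iff_mem_support i).mp hi
        apply hpv
        have h2 : s + Finsupp.single a 1 ∈ p.support := by
          rw [mem_support_iff] at hs ⊢
          rw [coeff_pderiv] at hs
          exact left_ne_zero_of_mul hs
        refine (mem_vars_iff_mem_support i).mpr ⟨_, h2, ?_⟩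
        simp at hsi ⊢
        omega
    · have h2 := aux_der_comp D f p
      have h3 : D (aeval f p) = 0 := by
        apply hD
        rw [← aeval_algebraMap_apply]
        exact hp0
      rw [h3, Finset.sum_eq_single a] at h2
      · exact (mul_eq_zero.mp h2.symm).resolve_left h1
      · intro j _ hj
        by_cases hjB : j ∈ B
        · rw [hB j hjB, mul_zero]
        · have : j ∉ p.vars := fun h => by
            rcases hpv h with h' | h'
            · exact hj h'
            · exact hjB h'
          rw [pderiv_eq_zero_of_notMem_vars this, map_zero, zero_mul]
      · simp

theorem aux_dirA {k : Type*} [Field k] [CharZero k] {m n : ℕ} {L : Type*} [Field L] [Algebra k L]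
    [Algebra (MvPolynomial (Fin n) k) L] [IsScalarTower k (MvPolynomial (Fin n) k) L]
    (g : MvPolynomial (Fin n) k)
    (hker : ∀ a, algebraMap (MvPolynomial (Fin n) k) L a = 0 ↔ g ∣ a)
    (f : Fin m → MvPolynomial (Fin n) k)
    (w : MvPolynomial (Fin m) k) (hw : Squarefree w) (hg : g * g ∣ aeval f w) :
    ∃ c ≠ 0, Matrix.vecMul c (auxF L f) = 0 := by
  classical
  by_contra hno
  set x : Fin m → L := fun j => algebraMap _ L (f j) with hx
  have hπ : ∀ p : MvPolynomial (Fin m) k, algebraMap _ L (aeval f p) = aeval x p := fun p =>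
    (aeval_algebraMap_apply L f _).symm
  obtain ⟨h, hh⟩ := hg
  have hw0 : aeval x w = 0 := by
    rw [← hπ, hker, hh, mul_assoc]; exact dvd_mul_right _ _
  have hwj : ∀ j, aeval x (pderiv j w) = 0 := by
    by_contra! hne
    obtain ⟨j, hj⟩ := hne
    refine hno ⟨fun j => aeval x (pderiv j w), fun h => hj (congrFun h j), ?_⟩
    ext l
    rw [← aux_pd f w l, hh, Pi.zero_apply, hker]
    simp only [pderiv_mul]
    refine ⟨pderiv l g * h + pderiv l g * h + g * pderiv l h, by ring⟩
  -- maximal independent B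
  let Ind : Finset (Fin m) → Prop := fun B => ∀ p : MvPolynomial (Fin m) k, 
    (p.vars : Set (Fin m)) ⊆ B → aeval x p = 0 → p = 0
  have hempty : Ind ∅ := by
    intro p hp h0
    have h1 : p.vars = ∅ := by simpa using hp
    rw [vars_eq_empty_iff_eq_C] at h1
    rw [h1, aeval_C, map_eq_zero] at h0
    rw [h1, h0, C_0]
  obtain ⟨B, hB⟩ : ∃ B, Maximal Ind B := by
    obtain ⟨B, -, hB⟩ := Set.Finite.exists_le_maximal (Set.toFinite {B | Ind B}) hempty
    exact ⟨B, hB⟩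
  have hnot : ∀ a ∉ B, ∃ p : MvPolynomial (Fin m) k, (p.vars : Set (Fin m)) ⊆ insert a (B : Set (Fin m)) ∧
      aeval x p = 0 ∧ p ≠ 0 := by
    intro a ha
    have : ¬ Ind (insert a B) := fun hI => 
      ha (hB.2 hI (Finset.subset_insert _ _) (Finset.mem_insert_self _ _))
    simp only [Ind] at this
    push Not at this
    obtain ⟨p, h1, h2, h3⟩ := this
    exact ⟨p, by simpa using h1, h2, h3⟩
  have hone : ∀ a b, a ∉ B → b ∉ B → a = b := by
    intro a b ha hb
    by_contra hab
    obtain ⟨va, hva⟩ := aux_surj _ hno (Pi.single a 1)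
    obtain ⟨vb, hvb⟩ := aux_surj _ hno (Pi.single b 1)
    let G : Fin n → L := fun l => algebraMap _ L (pderiv l g)
    obtain ⟨α, β, hαβ, hG⟩ : ∃ α β : L, ¬ (α = 0 ∧ β = 0) ∧ α * (G ⬝ᵥ va) + β * (G ⬝ᵥ vb) = 0 := by
      by_cases h0 : G ⬝ᵥ vb = 0
      · exact ⟨0, 1, by simp, by simp [h0]⟩
      · exact ⟨G ⬝ᵥ vb, - (G ⬝ᵥ va), by simp [h0], by ring⟩
    let D : Derivation k (MvPolynomial (Fin n) k) L := mkDerivation k (α • va + β • vb)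
    have hDX : ∀ l, D (X l) = (α • va + β • vb) l := fun l => mkDerivation_X _ _ _
    have hDg : D g = 0 := by
      have : D g = G ⬝ᵥ (α • va + β • vb) := by
        rw [aux_der D g]
        simp only [hDX]; rfl
      rw [this, dotProduct_add, dotProduct_smul, dotProduct_smul]
      exact hG
    have hDf : ∀ j, D (f j) = α * (Pi.single a 1 : Fin m → L) j + β * (Pi.single b 1 : Fin m → L) j := by
      intro j
      have : D (f j) = (auxF L f).mulVec (α • va + β • vb) j := by
        rw [aux_der D (f j)]
        simp only [hDX]; rfl
      rw [this, Matrix.mulVec_add, Matrix.mulVec_smul, Matrix.mulVec_smul, hva, hvb]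
      rfl
    have hD : ∀ a, algebraMap _ L a = 0 → D a = 0 := by
      intro a ha
      rw [hker] at ha
      obtain ⟨c, rfl⟩ := ha
      have hg0 : algebraMap _ L g = 0 := (hker g).mpr dvd_rfl
      rw [Derivation.leibniz, hDg, smul_zero, add_zero, Algebra.smul_def, hg0, zero_mul]
    have hBz : ∀ b ∈ (B : Set (Fin m)), D (f b) = 0 := by
      intro j hj
      have h1 : j ≠ a := fun h => ha (h ▸ hj)
      have h2 : j ≠ b := fun h => hb (h ▸ hj)
      rw [hDf]; simp [h1, h2]
    have h1 := aux_alg D f hD B hBz hB.1 a (hnot a ha)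
    have h2 := aux_alg D f hD B hBz hB.1 b (hnot b hb)
    rw [hDf] at h1 h2
    apply hαβ
    simp [hab] at h1
    simp [Ne.symm hab] at h2
    exact ⟨h1, h2⟩
  obtain ⟨p, hp, hpw, hp0⟩ := aux_factor x w hw.ne_zero hw0
  have hBne : ∃ i0, i0 ∉ B := by
    by_contra! hall
    exact hp.ne_zero (hB.1 p (fun i _ => hall i) hp0)
  obtain ⟨i0, hi0⟩ := hBne
  have hind : AlgebraicIndependent k (fun j : {j // j ≠ i0} => x j) := by
    refine aux_indep x {j | j ≠ i0} fun q hq hq0 => hB.1 q (fun i hi => ?_) hq0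
    by_contra hiB
    exact hq hi (hone i i0 hiB hi0)
  obtain ⟨u, hu⟩ := hpw
  obtain ⟨j, hj⟩ := aux_exists_pderiv p hp
  have h1 : p ∣ pderiv j w := aux_gauss x i0 hind p _ hp hp0 (hwj j)
  have h2 : pderiv j w = pderiv j p * u + p * pderiv j u := by rw [hu, pderiv_mul]
  rw [h2] at h1
  have h3 : p ∣ pderiv j p * u := (dvd_add_left (dvd_mul_right _ _)).mp h1
  rcases hp.prime.dvd_or_dvd h3 with h4 | h4
  · exact aux_not_dvd_pderiv p j hj h4
  · refine hp.not_isUnit (hw p ?_)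
    rw [hu]
    exact mul_dvd_mul_left _ h4

theorem aux_dirB {k : Type*} [Field k] [CharZero k] {m n : ℕ} {L : Type*} [Field L] [Algebra k L]
    [Algebra (MvPolynomial (Fin n) k) L] [IsScalarTower k (MvPolynomial (Fin n) k) L]
    (g : MvPolynomial (Fin n) k) (hgi : Irreducible g)
    (hker : ∀ a, algebraMap (MvPolynomial (Fin n) k) L a = 0 ↔ g ∣ a)
    (f : Fin m → MvPolynomial (Fin n) k)
    (hc : ∃ c ≠ 0, Matrix.vecMul c (auxF L f) = 0) :
    ∃ w : MvPolynomial (Fin m) k, Squarefree w ∧ g * g ∣ aeval f w := by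
  classical
  obtain ⟨c, hc0, hc⟩ := hc
  set x : Fin m → L := fun j => algebraMap _ L (f j) with hx
  have hπ : ∀ p : MvPolynomial (Fin m) k, algebraMap _ L (aeval f p) = aeval x p := fun p =>
    (aeval_algebraMap_apply L f _).symm
  -- any derivation kills the relation
  have hDc : ∀ D : Derivation k L L, ∑ j, c j * D (x j) = 0 := by
    intro D
    have h1 : ∀ j, D (x j) = ∑ l, auxF L f j l * D (algebraMap _ L (X l)) := fun j =>
      aux_der (D.compAlgebraMap (MvPolynomial (Fin n) k)) (f j)
    simp only [h1, Finset.mul_sum]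
    rw [Finset.sum_comm]
    refine Finset.sum_eq_zero fun l _ => ?_
    have h2 : ∑ j, c j * auxF L f j l = 0 := congrFun hc l
    simp only [← mul_assoc]
    rw [← Finset.sum_mul, h2, zero_mul]
  have hnind : ¬ AlgebraicIndependent k x := by
    intro hind
    apply hc0
    ext j
    obtain ⟨D, hD⟩ := aux_ext x hind (Pi.single j 1)
    have := hDc D
    simpa [hD, Pi.single_apply] using this
  rw [algebraicIndependent_iff] at hnind
  push Not at hnind
  obtain ⟨q, hq0, hqne⟩ := hnind
  obtain ⟨p, hp, -, hp0⟩ := aux_factor x q hqne hq0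
  have hgp : g ∣ aeval f p := by rw [← hker, hπ, hp0]
  by_cases hall : ∀ q, aeval x q = 0 → p ∣ q
  · obtain ⟨h, hh⟩ := hgp
    by_cases hgh : g ∣ h
    · exact ⟨p, hp.squarefree, by rw [hh]; exact mul_dvd_mul_left _ hgh⟩
    exfalso
    obtain ⟨i0, hi0⟩ := aux_exists_pderiv p hp
    have hpi0 : aeval x (pderiv i0 p) ≠ 0 := fun h0 => aux_not_dvd_pderiv p i0 hi0 (hall _ h0)
    have hind : AlgebraicIndependent k (fun j : {j // j ≠ i0} => x j) := by
      refine aux_indep x {j | j ≠ i0} fun q hq hq0 => ?_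
      by_contra hqne
      obtain ⟨r, hr⟩ := hall q hq0
      apply hi0
      apply pderiv_eq_zero_of_notMem_vars
      intro hv
      have hrne : r ≠ 0 := by rintro rfl; simp at hr; exact hqne hr
      have h1 : degreeOf i0 q = degreeOf i0 p + degreeOf i0 r := by
        rw [hr, degreeOf_mul_eq hp.ne_zero hrne]
      have h2 : degreeOf i0 q = 0 := by
        by_contra hne
        exact hq (mem_vars_iff_degreeOf_ne_zero.mpr hne) rfl
      have h3 : degreeOf i0 p = 0 := by omega
      exact mem_vars_iff_degreeOf_ne_zero.mp hv h3
    have hrel : ∀ i, i ≠ i0 → ∃ t, c i + c i0 * t = 0 ∧ aeval x (pderiv i p) + aeval x (pderiv i0 p) * t = 0 := by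
      intro i hi
      obtain ⟨D, hD⟩ := aux_ext _ hind (Pi.single ⟨i, hi⟩ 1)
      have hD' : ∀ j, j ≠ i0 → D (x j) = if j = i then 1 else 0 := by
        intro j hj
        have := hD ⟨j, hj⟩
        simpa [Pi.single_apply] using this
      have hsum : ∀ d : Fin m → L, ∑ j, d j * D (x j) = d i + d i0 * D (x i0) := by
        intro d
        rw [← Finset.add_sum_erase _ _ (Finset.mem_univ i0), add_comm]
        congr 1
        rw [Finset.sum_eq_single i]
        · rw [hD' i hi]; simp
        · intro b hb hbi
          rw [hD' b (Finset.ne_of_mem_erase hb)]; simp [hbi]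
        · intro h; exact absurd (Finset.mem_erase.mpr ⟨hi, Finset.mem_univ _⟩) h
      refine ⟨D (x i0), ?_, ?_⟩
      · rw [← hsum c]; exact hDc D
      · rw [← hsum fun j => aeval x (pderiv j p)]
        have h1 := aux_chain D x p
        rw [hp0, map_zero] at h1
        exact h1.symm
    have hprop : ∀ i, aeval x (pderiv i0 p) * c i = c i0 * aeval x (pderiv i p) := by
      intro i
      by_cases hi : i = i0
      · subst hi; ring
      · obtain ⟨t, h1, h2⟩ := hrel i hi
        linear_combination (aeval x (pderiv i0 p)) * h1 - c i0 * h2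
    have hci0 : c i0 ≠ 0 := by
      intro h0
      apply hc0
      ext i
      have := hprop i
      rw [h0, zero_mul] at this
      exact (mul_eq_zero.mp this).resolve_left hpi0
    obtain ⟨l, hl⟩ := aux_exists_pderiv g hgi
    have h1 : algebraMap _ L (pderiv l (aeval f p)) = 0 := by
      have h2 : c i0 * algebraMap _ L (pderiv l (aeval f p)) = 0 := by
        rw [aux_pd f p l]
        simp only [Matrix.vecMul, dotProduct, Finset.mul_sum, ← mul_assoc]
        have : ∀ j, c i0 * aeval x (pderiv j p) * auxF L f j l = aeval x (pderiv i0 p) * (c j * auxF L f j l) := by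
          intro j
          rw [← hprop, mul_assoc]
        rw [Finset.sum_congr rfl fun j _ => this j, ← Finset.mul_sum]
        have h3 : ∑ j, c j * auxF L f j l = 0 := congrFun hc l
        rw [h3, mul_zero]
      exact (mul_eq_zero.mp h2).resolve_left hci0
    rw [hker, hh, pderiv_mul] at h1
    have h2 : g ∣ pderiv l g * h := (dvd_add_left (dvd_mul_right _ _)).mp h1
    rcases hgi.prime.dvd_or_dvd h2 with h3 | h3
    · exact aux_not_dvd_pderiv g l hl h3
    · exact hgh h3
  · push Not at hall
    obtain ⟨q, hq0, hpq⟩ := hall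
    have hqne : q ≠ 0 := by rintro rfl; exact hpq (dvd_zero _)
    -- factor q as irreducible in kernel not divisible by p
    obtain ⟨r, hr, hrq, hr0⟩ := aux_factor x q hqne hq0
    have hpr : ¬ p ∣ r := fun h => hpq (h.trans hrq)
    refine ⟨p * r, squarefree_mul_iff.mpr ⟨hp.isRelPrime_iff_not_dvd.mpr hpr, hp.squarefree, hr.squarefree⟩, ?_⟩
    rw [map_mul]
    exact mul_dvd_mul hgp (by rw [← hker, hπ, hr0])

theorem aux_main {k : Type*} [Field k] [CharZero k] {m n : ℕ}
    (g : MvPolynomial (Fin n) k) (hgi : Irreducible g)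
    (f : Fin m → MvPolynomial (Fin n) k) :
    (∀ i : Fin m → Fin n, StrictMono i → g ∣ jacDet f i) ↔
    ∃ w : MvPolynomial (Fin m) k, Squarefree w ∧ g * g ∣ aeval f w := by
  have hprime : (Ideal.span {g}).IsPrime := (Ideal.span_singleton_prime hgi.ne_zero).mpr hgi.prime
  let L := FractionRing (MvPolynomial (Fin n) k ⧸ Ideal.span {g})
  have hker : ∀ a, algebraMap (MvPolynomial (Fin n) k) L a = 0 ↔ g ∣ a := by
    intro a
    rw [IsScalarTower.algebraMap_apply _ (MvPolynomial (Fin n) k ⧸ Ideal.span {g}) L,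
      map_eq_zero_iff _ (IsFractionRing.injective _ L), Ideal.Quotient.algebraMap_eq,
      Ideal.Quotient.eq_zero_iff_mem, Ideal.mem_span_singleton]
  have h1 : (∀ i : Fin m → Fin n, StrictMono i → g ∣ jacDet f i) ↔
      ∀ i : Fin m → Fin n, StrictMono i → ((auxF L f).submatrix id i).det = 0 := by
    refine forall₂_congr fun i _ => ?_
    rw [← hker, jacDet, RingHom.map_det]
    rfl
  rw [h1, aux_minor]
  exact ⟨aux_dirB g hgi hker f, fun ⟨w, hw, h⟩ => aux_dirA g hker f w hw h⟩

/-- For algebraically independent `f₁,…,f_m`, `dgcd(f₁,…,f_m) ∈ k ∖ {0}` iff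
for every square-free `w ∈ k[x₁,…,x_m]` the polynomial `w(f₁,…,f_m)` is
square-free in `k[x₁,…,xₙ]`. -/
theorem statement6 {k : Type*} [Field k] [CharZero k] {m n : ℕ}
    (hm : 1 ≤ m) (hmn : m ≤ n)
    (f : Fin m → MvPolynomial (Fin n) k)
    (hf : AlgebraicIndependent k f) :
    (∃ c : k, c ≠ 0 ∧ IsDgcd f (C c)) ↔
      ∀ w : MvPolynomial (Fin m) k, Squarefree w → Squarefree (aeval f w) := by
  constructor
  · rintro ⟨c, hc, -, hd⟩ w hw
    have hne : aeval f w ≠ 0 := fun h => hw.ne_zero (hf.eq_zero_of_aeval_eq_zero _ h)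
    rw [squarefree_iff_irreducible_sq_not_dvd_of_ne_zero hne]
    intro g hg hgg
    have h1 := hd g ((aux_main g hg f).mpr ⟨w, hw, hgg⟩)
    exact hg.not_isUnit (isUnit_of_dvd_unit h1 (IsUnit.map C (isUnit_iff_ne_zero.mpr hc)))
  · intro h
    have hirr : ∀ g : MvPolynomial (Fin n) k, Irreducible g →
        ¬ ∀ i : Fin m → Fin n, StrictMono i → g ∣ jacDet f i := by
      intro g hg hall
      obtain ⟨w, hw, hgg⟩ := (aux_main g hg f).mp hall
      exact hg.not_isUnit (h w hw g hgg)
    refine ⟨1, one_ne_zero, fun i _ => by simp, fun e he => ?_⟩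
    rw [C_1, ← isUnit_iff_dvd_one]
    by_contra hu
    by_cases h0 : e = 0
    · subst h0
      let z : Fin n := ⟨0, by omega⟩
      refine hirr (X z) (X_prime (i := z)).irreducible fun i hi => ?_
      exact (dvd_zero _).trans (he i hi)
    · obtain ⟨g, hg, hge⟩ := WfDvdMonoid.exists_irreducible_factor hu h0
      exact hirr g hg fun i hi => hge.trans (he i hi)
end
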